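/- Let k ≥ 3 be an integer and ζ > 0 a real number. There exists n₁ = n₁(k,ζ) such that for every integer n ≥ n₁ the following holds. Let H be a (1,k)-partite (k+1)-graph with partition classes {x_1, …, x_{⌊n/k⌋}}, [n] such that d_H(x_i) > C(n,k) − C(n−t+1,k) for i ∈ [t] and d_H(x_i) = C(n,k) for t < i ≤ ⌊n/k⌋, where t is an integer with n/(3k²) ≤ t ≤ (1−ζ)n/k. Then for every balanced (k+1)-element set R ⊆ V(H), the number of R-absorbing k(k+1)-element sets in H is at least ζ^k · C(n,k)^{k+1} / (6k² · 2^k · (k²)!). -/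

import Mathlib

open Finset

/-- The binomial ratio `C(a,k) / C(n,k)` is at most `a / n`. -/
lemma mul_choose_le_mul_choose {a n k : ℕ} (ha : a ≤ n) (hk : 1 ≤ k) :
    n * a.choose k ≤ a * n.choose k := by
  obtain ⟨k, rfl⟩ : ∃ j, k = j + 1 := ⟨k - 1, by omega⟩
  rcases a with _ | a
  · simp
  obtain ⟨n, rfl⟩ : ∃ j, n = j + 1 := ⟨n - 1, by omega⟩
  have h1 := Nat.add_one_mul_choose_eq a k
  have h2 := Nat.add_one_mul_choose_eq n k
  have h3 : a.choose k ≤ n.choose k := Nat.choose_le_choose k (by omega)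
  refine Nat.le_of_mul_le_mul_right (c := k + 1) ?_ (by omega)
  calc (n + 1) * (a + 1).choose (k + 1) * (k + 1)
      = (n + 1) * ((a + 1) * a.choose k) := by rw [h1]; ring
    _ ≤ (n + 1) * ((a + 1) * n.choose k) := by gcongr
    _ = (a + 1) * ((n + 1) * n.choose k) := by ring
    _ = _ := by rw [h2]; ring

lemma choose_le_choose_sub_add (n k j : ℕ) (hj : j ≤ n) (hk : 1 ≤ k) :
    n.choose k ≤ (n - j).choose k + j * (n - 1).choose (k - 1) := by
  obtain ⟨k, rfl⟩ : ∃ j, k = j + 1 := ⟨k - 1, by omega⟩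
  induction j with
  | zero => simp
  | succ j ih =>
    have h := ih (by omega)
    have e : n - j = (n - (j + 1)) + 1 := by omega
    rw [e, Nat.choose_succ_succ] at h
    have h2 : (n - (j + 1)).choose k ≤ (n - 1).choose k := Nat.choose_le_choose k (by omega)
    simp only [Nat.add_sub_cancel] at h ⊢
    linarith [add_mul j 1 ((n - 1).choose k)]

/-- A family of `k`-sets on `n` points of size more than `C(n,k) - C(n-t+1,k)` keeps a positive
proportion of its members after removing those that meet a fixed set of `k` points. -/
lemma card_inter_powersetCard_compl_ge {β : Type*} [Fintype β] [DecidableEq β] {k t : ℕ}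
    (hk : 1 ≤ k) (ht : 1 ≤ t) (htn : t ≤ Fintype.card β)
    (N : Finset (Finset β)) (hN : N ⊆ univ.powersetCard k) (T : Finset β) (hT : #T = k)
    (hd : (Fintype.card β).choose k ≤ #N + (Fintype.card β - t + 1).choose k) :
    t * (Fintype.card β).choose k ≤
      Fintype.card β * #(N ∩ Tᶜ.powersetCard k) + (1 + k ^ 2) * (Fintype.card β).choose k := by
  set n := Fintype.card β
  have hkn : k ≤ n := hT ▸ card_le_univ T
  have h1 : #(N ∪ Tᶜ.powersetCard k) ≤ n.choose k := by
    refine (card_le_card (union_subset hN (powersetCard_mono (subset_univ _)))).trans ?_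
    rw [card_powersetCard, card_univ]
  have h2 := card_union_add_card_inter N (Tᶜ.powersetCard k)
  rw [card_powersetCard, card_compl, hT] at h2
  have h3 := choose_le_choose_sub_add n k k hkn hk
  have h4 := mul_choose_le_mul_choose (a := n - t + 1) (n := n) (k := k) (by omega) hk
  have h5 : n * (n - 1).choose (k - 1) = n.choose k * k := by
    obtain ⟨k, rfl⟩ : ∃ j, k = j + 1 := ⟨k - 1, by omega⟩
    obtain ⟨m, hm⟩ : ∃ j, n = j + 1 := ⟨n - 1, by omega⟩
    rw [hm]
    exact Nat.add_one_mul_choose_eq m k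
  have h6 : n.choose k ≤ #(N ∩ Tᶜ.powersetCard k) + (n - t + 1).choose k
      + k * (n - 1).choose (k - 1) := by
    change #(N ∪ Tᶜ.powersetCard k) + _ = _ + (n - k).choose k at h2
    omega
  have h7 := Nat.mul_le_mul_left n h6
  have e : n - t + 1 = n + 1 - t := by omega
  zify [show t ≤ n + 1 by omega] at *
  rw [e, Nat.cast_sub (by omega)] at *
  nlinarith

/-- Double counting the pairs `U ⊆ S` with `U` in a given family and `S` avoiding `T`. -/
lemma card_mul_choose_le_card_supersets_mul {β : Type*} [Fintype β] [DecidableEq β] {k l : ℕ}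
    (hkl : k ≤ l) (T : Finset β) (N : Finset (Finset β)) (hN : N ⊆ Tᶜ.powersetCard k) :
    #N * (Fintype.card β - #T - k).choose (l - k) ≤
      #{S ∈ Tᶜ.powersetCard l | ∃ U ∈ N, U ⊆ S} * l.choose k := by
  refine card_mul_le_card_mul (fun U S => U ⊆ S) ?_ ?_
  · intro U hU
    obtain ⟨hUT, hUc⟩ := mem_powersetCard.1 (hN hU)
    have : (Fintype.card β - #T - k).choose (l - k) = #((Tᶜ \ U).powersetCard (l - k)) := by
      rw [card_powersetCard, card_sdiff_of_subset hUT, card_compl, hUc]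
    rw [this]
    refine card_le_card_of_injOn (fun W => U ∪ W) ?_ ?_
    · intro W hW
      obtain ⟨hWs, hWc⟩ := mem_powersetCard.1 hW
      have hdis : Disjoint U W := (disjoint_sdiff.mono_right hWs)
      simp only [bipartiteAbove, coe_filter, Set.mem_ofPred_eq, mem_filter, mem_powersetCard]
      refine ⟨⟨⟨union_subset hUT (hWs.trans sdiff_subset), ?_⟩, U, hU, subset_union_left⟩,
        subset_union_left⟩
      rw [card_union_of_disjoint hdis]
      omega
    · intro W hW W' hW' h
      have hd : Disjoint U W := disjoint_sdiff.mono_right (mem_powersetCard.1 hW).1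
      have hd' : Disjoint U W' := disjoint_sdiff.mono_right (mem_powersetCard.1 hW').1
      rw [← union_sdiff_cancel_left hd, ← union_sdiff_cancel_left hd']
      exact congrArg (· \ U) h
  · intro S hS
    obtain ⟨-, hSc⟩ := mem_powersetCard.1 (mem_filter.1 hS).1
    rw [← hSc, ← card_powersetCard]
    refine card_le_card fun U hU => ?_
    obtain ⟨hU, hUS⟩ := mem_filter.1 hU
    exact mem_powersetCard.2 ⟨hUS, (mem_powersetCard.1 (hN hU)).2⟩

/-- Edges with distinct left vertices and disjoint right parts form a matching. -/
lemma exists_matching {ι α β : Type*} [Fintype ι] [DecidableEq α] [DecidableEq β]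
    (H : Finset (Finset (α ⊕ β))) (f : ι → α) (hf : Function.Injective f) (A : ι → Finset β)
    (hA : Pairwise fun i j => Disjoint (A i) (A j))
    (hH : ∀ i, ({f i} : Finset α).disjSum (A i) ∈ H) :
    ∃ M ⊆ H, #M = Fintype.card ι ∧ (∀ e ∈ M, ∀ e' ∈ M, e ≠ e' → Disjoint e e') ∧
      M.biUnion id = (univ.image f).disjSum (univ.biUnion A) := by
  classical
  refine ⟨univ.image fun i => ({f i} : Finset α).disjSum (A i), ?_, ?_, ?_, ?_⟩
  · exact image_subset_iff.2 fun i _ => hH i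
  · rw [card_image_of_injective _ ?_, card_univ]
    intro i j h
    have : Sum.inl (f i) ∈ ({f j} : Finset α).disjSum (A j) := by
      rw [← show _ = ({f j} : Finset α).disjSum (A j) from h]
      simp
    simpa [hf.eq_iff] using this
  · simp only [mem_image, mem_univ, true_and]
    rintro _ ⟨i, rfl⟩ _ ⟨j, rfl⟩ hne
    have hij : i ≠ j := fun h => hne (by rw [h])
    rw [disjoint_left]
    rintro (a | b)
    · simp only [inl_mem_disjSum, mem_singleton]
      rintro rfl h
      exact hij (hf h)
    · simpa using fun h => disjoint_left.1 (hA hij) h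
  · ext (a | b)
    · simp [eq_comm]
    · simp

/-- A finite set of size `k * l` splits into `k` disjoint parts of size `l`. -/
lemma exists_equipartition {β : Type*} [DecidableEq β] {k l : ℕ} (S : Finset β)
    (hS : #S = k * l) :
    ∃ W : Fin k → Finset β, (∀ i, #(W i) = l) ∧ (Pairwise fun i j => Disjoint (W i) (W j)) ∧
      univ.biUnion W = S := by
  have e : Fin k × Fin l ≃ S := Fintype.equivOfCardEq (by simp [hS])
  refine ⟨fun i => univ.image fun j => (e (i, j) : β), fun i => ?_, fun i i' h => ?_, ?_⟩
  · rw [card_image_of_injective, card_univ, Fintype.card_fin]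
    intro j j' h
    simpa using e.injective (Subtype.ext h)
  · refine disjoint_left.2 ?_
    simp only [mem_image, mem_univ, true_and]
    rintro _ ⟨j, rfl⟩ ⟨j', h'⟩
    have := e.injective (Subtype.ext h')
    simp only [Prod.mk.injEq] at this
    exact h this.1.symm
  · ext b
    simp only [mem_biUnion, mem_image, mem_univ, true_and]
    constructor
    · rintro ⟨i, j, rfl⟩
      exact (e (i, j)).2
    · intro hb
      exact ⟨(e.symm ⟨b, hb⟩).1, (e.symm ⟨b, hb⟩).2, by simp⟩

lemma exists_enumeration {α : Type*} [DecidableEq α] {k : ℕ} (X : Finset α) (hX : #X = k) :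
    ∃ f : Fin k → α, Function.Injective f ∧ univ.image f = X := by
  have e : Fin k ≃ X := Fintype.equivOfCardEq (by simp [hX])
  refine ⟨fun i => e i, fun i j h => e.injective (Subtype.ext h), ?_⟩
  ext a
  simp only [mem_image, mem_univ, true_and]
  exact ⟨by rintro ⟨i, rfl⟩; exact (e i).2, fun ha => ⟨e.symm ⟨a, ha⟩, by simp⟩⟩

/-- If all vertices of `X` have full degree and `{a} ∪ U` is an edge with `U ⊆ S`, then `X ∪ S`
absorbs `{a} ∪ T`. -/
lemma exists_matchings_of_full_degree {α β : Type*} [DecidableEq α] [DecidableEq β] {k : ℕ}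
    (hk : 1 ≤ k) (H : Finset (Finset (α ⊕ β))) (X : Finset α) (hX : #X = k)
    (hfull : ∀ x ∈ X, ∀ A : Finset β, #A = k → ({x} : Finset α).disjSum A ∈ H)
    (a : α) (ha : a ∉ X) (S T U : Finset β) (hS : #S = k ^ 2) (hT : #T = k) (hU : #U = k)
    (hUS : U ⊆ S) (hST : Disjoint S T) (haU : ({a} : Finset α).disjSum U ∈ H) :
    (∃ M ⊆ H, (∀ e ∈ M, ∀ f ∈ M, e ≠ f → Disjoint e f) ∧ M.biUnion id = X.disjSum S) ∧
    (∃ M ⊆ H, #M = k + 1 ∧ (∀ e ∈ M, ∀ f ∈ M, e ≠ f → Disjoint e f) ∧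
      ∀ e ∈ M, e ⊆ X.disjSum S ∪ ({a} : Finset α).disjSum T) := by
  obtain ⟨f, hf, rfl⟩ := exists_enumeration X hX
  obtain ⟨u, hu, rfl⟩ := exists_enumeration U hU
  obtain ⟨v, hv, rfl⟩ := exists_enumeration T hT
  obtain ⟨W, hWc, hWd, hWS⟩ := exists_equipartition (k := k) (l := k - 1) (S \ univ.image u) (by
    rw [card_sdiff_of_subset hUS, hS, hU, sq, Nat.mul_sub, mul_one])
  have hWsub : ∀ i, W i ⊆ S \ univ.image u := fun i =>
    hWS ▸ subset_biUnion_of_mem W (mem_univ i)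
  have huS : ∀ i, u i ∈ S := fun i => hUS (by simp)
  have huW : ∀ i j, u i ∉ W j := fun i j h => (mem_sdiff.1 (hWsub j h)).2 (by simp)
  have hvS : ∀ i, v i ∉ S := fun i h => disjoint_left.1 hST h (by simp)
  have hvW : ∀ i j, v i ∉ W j := fun i j h => hvS i (mem_sdiff.1 (hWsub j h)).1
  have hpair : ∀ g : Fin k → β, Function.Injective g → (∀ i j, g i ∉ W j) →
      Pairwise fun i j => Disjoint (insert (g i) (W i)) (insert (g j) (W j)) := by
    intro g hg hgW i j hij
    simp [disjoint_insert_left, disjoint_insert_right, hgW, hWd hij, hg.eq_iff, hij.symm]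
  have hedge : ∀ g : Fin k → β, (∀ i j, g i ∉ W j) → ∀ i,
      ({f i} : Finset α).disjSum (insert (g i) (W i)) ∈ H := by
    intro g hgW i
    refine hfull _ (by simp) _ ?_
    rw [card_insert_of_notMem (hgW i i), hWc]
    omega
  constructor
  · obtain ⟨M, hMH, -, hMd, hM⟩ := exists_matching H f hf (fun i => insert (u i) (W i))
      (hpair u hu huW) (hedge u huW)
    refine ⟨M, hMH, hMd, hM.trans ?_⟩
    congr 1
    ext b
    have hb : b ∈ S \ univ.image u ↔ ∃ i, b ∈ W i := by rw [← hWS]; simp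
    simp only [mem_sdiff, mem_image, mem_univ, true_and] at hb
    simp only [mem_biUnion, mem_univ, true_and, mem_insert]
    constructor
    · rintro ⟨i, rfl | h⟩
      · exact huS i
      · exact (hb.2 ⟨i, h⟩).1
    · intro h
      by_cases h' : ∃ i, u i = b
      · obtain ⟨i, rfl⟩ := h'
        exact ⟨i, Or.inl rfl⟩
      · obtain ⟨i, hi⟩ := hb.1 ⟨h, h'⟩
        exact ⟨i, Or.inr hi⟩
  · have hUd : ∀ i, Disjoint (univ.image u) (insert (v i) (W i)) := by
      intro i
      rw [disjoint_left]
      simp only [mem_image, mem_univ, true_and, mem_insert]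
      rintro _ ⟨j, rfl⟩ (h | h)
      · exact hvS i (h ▸ huS j)
      · exact huW _ _ h
    obtain ⟨M, hMH, hMc, hMd, hM⟩ := exists_matching H (ι := Option (Fin k))
      (fun o => o.elim a f) (by
        rintro (_ | i) (_ | j) h
        · rfl
        · exact absurd (by simp [show a = f j from h]) ha
        · exact absurd (by simp [← show f i = a from h]) ha
        · exact congrArg some (hf h))
      (fun o => o.elim (univ.image u) fun i => insert (v i) (W i)) (by
        rintro (_ | i) (_ | j) h
        · exact absurd rfl h
        · exact hUd j
        · exact (hUd i).symm
        · exact hpair v hv hvW fun h' => h (congrArg some h')) (by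
        rintro (_ | i)
        · exact haU
        · exact hedge v hvW i)
    refine ⟨M, hMH, by simpa using hMc, hMd, fun e he => ?_⟩
    refine (subset_biUnion_of_mem id he).trans (hM.trans_subset ?_)
    rintro (x | b)
    · simp only [inl_mem_disjSum, mem_union, mem_image, mem_univ, true_and, mem_singleton]
      rintro ⟨_ | i, rfl⟩
      · exact Or.inr rfl
      · exact Or.inl ⟨i, rfl⟩
    · simp only [inr_mem_disjSum, mem_union, mem_biUnion, mem_univ, true_and]
      rintro ⟨_ | i, h⟩
      · exact Or.inl (hUS h)
      · rcases mem_insert.1 h with rfl | h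
        · exact Or.inr (by simp)
        · exact Or.inl (mem_sdiff.1 (hWsub i h)).1

lemma card_filter_isLeft {α β : Type*} (s : Finset (α ⊕ β)) :
    #(s.filter fun v => v.isLeft = true) = #s.toLeft := by
  rw [← card_map (s := s.toLeft) Function.Embedding.inl]
  congr 1
  ext (a | b) <;> simp

lemma card_filter_isRight {α β : Type*} (s : Finset (α ⊕ β)) :
    #(s.filter fun v => v.isRight = true) = #s.toRight := by
  rw [← card_map (s := s.toRight) Function.Embedding.inr]
  congr 1
  ext (a | b) <;> simp

lemma eq_singleton_disjSum_toRight {α β : Type*} {s : Finset (α ⊕ β)} {a : α}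
    (hs : #s.toLeft = 1) (ha : Sum.inl a ∈ s) : s = ({a} : Finset α).disjSum s.toRight := by
  obtain ⟨b, hb⟩ := card_eq_one.1 hs
  have : a ∈ s.toLeft := by simpa using ha
  obtain rfl : a = b := by simpa [hb] using this
  rw [← hb, toLeft_disjSum_toRight]

/-- In a `(1,k)`-partite `(k+1)`-graph, every edge at `a` comes from a `k`-set in the
neighbourhood of `a`. -/
lemma degree_le_card_neighbourhood {α β : Type*} [DecidableEq α] [DecidableEq β] [Fintype β]
    {k : ℕ} (H : Finset (Finset (α ⊕ β)))
    (hH : ∀ e ∈ H, #(e.filter fun v => v.isLeft = true) = 1 ∧ #e = k + 1) (a : α) :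
    #{e ∈ H | Sum.inl a ∈ e} ≤
      #{U ∈ (univ : Finset β).powersetCard k | ({a} : Finset α).disjSum U ∈ H} := by
  have key : ∀ e ∈ H, Sum.inl a ∈ e → e = ({a} : Finset α).disjSum e.toRight := fun e he hae =>
    eq_singleton_disjSum_toRight (card_filter_isLeft e ▸ (hH e he).1) hae
  refine card_le_card_of_injOn toRight ?_ ?_
  · intro e he
    obtain ⟨he, hae⟩ := mem_filter.1 he
    have h := key e he hae
    have hc := (hH e he).2
    rw [h, card_disjSum, card_singleton] at hc
    simp only [coe_filter, Set.mem_ofPred_eq, mem_powersetCard, subset_univ, true_and]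
    exact ⟨by omega, h ▸ he⟩
  · intro e he e' he' h
    obtain ⟨he, hae⟩ := mem_filter.1 he
    obtain ⟨he', hae'⟩ := mem_filter.1 he'
    rw [key e he hae, key e' he' hae', h]

/-- The arithmetic behind the count of absorbing sets: `N` counts the admissible `U`, `P` the
admissible right parts and `x` the available vertices of full degree. -/
lemma absorbing_count_le {k n x N P : ℕ} {ζ : ℝ} (hk : 3 ≤ k) (hζ : 0 < ζ)
    (hn : 6 * k ^ 2 * (1 + k ^ 2) ≤ n) (hζn : 2 * (k : ℝ) * (k + 1) ≤ ζ * n)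
    (hx : ζ * n / k - 2 ≤ x) (hN : (n.choose k : ℝ) ≤ 6 * k ^ 2 * N)
    (hP : N * (n - k - k).choose (k ^ 2 - k) ≤ P * (k ^ 2).choose k) :
    ζ ^ k * (n.choose k : ℝ) ^ (k + 1) / (6 * (k : ℝ) ^ 2 * 2 ^ k * ((k ^ 2).factorial : ℝ))
      ≤ x.choose k * P := by
  have hk0 : (3 : ℝ) ≤ k := by exact_mod_cast hk
  have hkk : k ≤ k ^ 2 := by nlinarith
  have hnR : 6 * (k : ℝ) ^ 2 * (1 + k ^ 2) ≤ n := by exact_mod_cast hn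
  have hn0 : (0 : ℝ) < n := lt_of_lt_of_le (by positivity) hnR
  have hy : ζ * n / (2 * k) ≤ (x + 1 - k : ℕ) := by
    have h1 : ((x + 1 : ℕ) : ℝ) - k ≤ (x + 1 - k : ℕ) := by
      rw [sub_le_iff_le_add]; norm_cast; omega
    have h2 : (k : ℝ) + 1 ≤ ζ * n / (2 * k) := by
      rw [le_div_iff₀ (by positivity)]; linarith
    have h3 : ζ * n / k = ζ * n / (2 * k) + ζ * n / (2 * k) := by field_simp; norm_num
    push_cast at h1
    linarith
  have hz : (n : ℝ) ^ (k - 1) / 2 ≤ ((n - k - k + 1 - (k ^ 2 - k) : ℕ) : ℝ) ^ (k - 1) := by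
    have h1 : (n : ℝ) * (1 + (-((k ^ 2 + k) / n))) ≤ (n - k - k + 1 - (k ^ 2 - k) : ℕ) := by
      have : (n : ℝ) * (1 + (-((k ^ 2 + k) / n))) = n - (k ^ 2 + k) := by field_simp; ring
      rw [this, sub_le_iff_le_add]
      norm_cast
      omega
    have hδ : ((k : ℝ) ^ 2 + k) / n * (2 * (k - 1)) ≤ 1 := by
      rw [div_mul_eq_mul_div, div_le_one hn0]
      nlinarith [pow_pos (by linarith : (0 : ℝ) < k) 3, pow_pos (by linarith : (0 : ℝ) < k) 2]
    have hδ1 : ((k : ℝ) ^ 2 + k) / n ≤ 1 := by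
      rw [div_le_one hn0]; nlinarith [pow_pos (by linarith : (0 : ℝ) < k) 2]
    have h2 := one_add_mul_le_pow (a := -(((k : ℝ) ^ 2 + k) / n)) (by linarith) (k - 1)
    rw [Nat.cast_sub (by omega), Nat.cast_one] at h2
    calc (n : ℝ) ^ (k - 1) / 2 = (n : ℝ) ^ (k - 1) * (1 / 2) := by ring
      _ ≤ (n : ℝ) ^ (k - 1) * (1 + -(((k : ℝ) ^ 2 + k) / n)) ^ (k - 1) := by
        gcongr
        linarith
      _ = ((n : ℝ) * (1 + -(((k : ℝ) ^ 2 + k) / n))) ^ (k - 1) := by rw [mul_pow]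
      _ ≤ _ := pow_le_pow_left₀ (mul_nonneg hn0.le (by linarith)) h1 _
  have hA : ((x + 1 - k : ℕ) : ℝ) ^ k ≤ k.factorial * x.choose k := by
    have := Nat.pow_sub_le_descFactorial x k
    rw [Nat.descFactorial_eq_factorial_mul_choose] at this
    exact_mod_cast this
  have hB : ((n - k - k + 1 - (k ^ 2 - k) : ℕ) : ℝ) ^ (k ^ 2 - k) ≤
      (k ^ 2 - k).factorial * (n - k - k).choose (k ^ 2 - k) := by
    have := Nat.pow_sub_le_descFactorial (n - k - k) (k ^ 2 - k)
    rw [Nat.descFactorial_eq_factorial_mul_choose] at this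
    exact_mod_cast this
  have hC : (k.factorial : ℝ) * n.choose k ≤ n ^ k := by
    have := Nat.descFactorial_le_pow n k
    rw [Nat.descFactorial_eq_factorial_mul_choose] at this
    exact_mod_cast this
  have hD : ((k ^ 2).choose k : ℝ) * k.factorial * (k ^ 2 - k).factorial = (k ^ 2).factorial := by
    exact_mod_cast Nat.choose_mul_factorial_mul_factorial hkk
  set y : ℝ := ((x + 1 - k : ℕ) : ℝ)
  set z : ℝ := ((n - k - k + 1 - (k ^ 2 - k) : ℕ) : ℝ)
  have hfac : (2 : ℝ) * k ≤ k.factorial := by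
    obtain ⟨j, rfl⟩ : ∃ j, k = j + 1 := ⟨k - 1, by omega⟩
    have : 2 ≤ j.factorial := (Nat.factorial_le (by omega : 2 ≤ j))
    rw [Nat.factorial_succ]
    push_cast
    have : (2 : ℝ) ≤ j.factorial := by exact_mod_cast this
    nlinarith
  have hE : ζ * (n : ℝ) ^ k ≤ 2 * k.factorial * (y * z ^ (k - 1)) := by
    have h := mul_le_mul hy hz (by positivity) (by positivity)
    have h1 : ζ * n / (2 * k) * ((n : ℝ) ^ (k - 1) / 2) = ζ * (n : ℝ) ^ k / (4 * k) := by
      rw [← Nat.sub_add_cancel (by omega : 1 ≤ k), pow_succ]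
      simp only [Nat.add_sub_cancel]
      field_simp
      norm_num
    rw [h1, div_le_iff₀ (by positivity)] at h
    have h0 : (0 : ℝ) ≤ y * z ^ (k - 1) := by positivity
    nlinarith
  have hF : ζ ^ k * (n.choose k : ℝ) ^ k ≤ 2 ^ k * (y ^ k * z ^ (k ^ 2 - k)) := by
    have hpos : (0 : ℝ) < (k.factorial : ℝ) ^ k := by positivity
    refine le_of_mul_le_mul_left ?_ hpos
    calc (k.factorial : ℝ) ^ k * (ζ ^ k * (n.choose k : ℝ) ^ k)
        = (ζ * (k.factorial * n.choose k)) ^ k := by ring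
      _ ≤ (ζ * (n : ℝ) ^ k) ^ k := by gcongr
      _ ≤ (2 * k.factorial * (y * z ^ (k - 1))) ^ k := by gcongr
      _ = _ := by
        have : k ^ 2 - k = (k - 1) * k := by rw [sq, Nat.sub_mul, one_mul]
        rw [this, pow_mul, mul_pow, mul_pow, mul_pow]; ring
  have hG : ζ ^ k * (n.choose k : ℝ) ^ k ≤ 2 ^ k * ((k.factorial * x.choose k) *
      ((k ^ 2 - k).factorial * (n - k - k).choose (k ^ 2 - k))) := by
    refine hF.trans ?_
    gcongr
  have hP' : (N : ℝ) * (n - k - k).choose (k ^ 2 - k) ≤ P * (k ^ 2).choose k := by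
    exact_mod_cast hP
  rw [div_le_iff₀ (by positivity), pow_succ, ← mul_assoc]
  calc ζ ^ k * (n.choose k : ℝ) ^ k * n.choose k
      ≤ (2 ^ k * ((k.factorial * x.choose k) *
        ((k ^ 2 - k).factorial * (n - k - k).choose (k ^ 2 - k)))) * (6 * k ^ 2 * N) := by
        gcongr
    _ = 6 * k ^ 2 * 2 ^ k * (k.factorial * x.choose k * (k ^ 2 - k).factorial) *
        (N * (n - k - k).choose (k ^ 2 - k)) := by ring
    _ ≤ 6 * k ^ 2 * 2 ^ k * (k.factorial * x.choose k * (k ^ 2 - k).factorial) *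
        (P * (k ^ 2).choose k) := by gcongr
    _ = _ := by rw [← hD]; ring

lemma card_filter_le_val_ge (m t : ℕ) : m - t ≤ #{i : Fin m | t ≤ (i : ℕ)} := by
  have h1 := card_filter_add_card_filter_not (s := (univ : Finset (Fin m)))
    (fun i => t ≤ (i : ℕ))
  have h2 : #{i : Fin m | ¬ t ≤ (i : ℕ)} ≤ #(range t) :=
    card_le_card_of_injOn (fun i => (i : ℕ)) (fun i hi => by simpa using hi)
      (fun i _ j _ h => Fin.ext h)
  rw [card_univ, Fintype.card_fin] at h1
  rw [card_range] at h2
  omega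

open Classical in
/-- Claim 1 in the proof of the Absorbing Lemma: in the setting of Lemma 4.2, for every
balanced `(k+1)`-set `R`, the number of `R`-absorbing balanced `k(k+1)`-sets in `H` is at
least `ζ^k · C(n,k)^{k+1} / (6k² · 2^k · (k²)!)`. -/
theorem stmt_6 (k : ℕ) (hk : 3 ≤ k) (ζ : ℝ) (hζ : 0 < ζ) :
    ∃ n₁ : ℕ, ∀ n : ℕ, n₁ ≤ n → ∀ t : ℕ,
      (n : ℝ) / (3 * k ^ 2) ≤ t → (t : ℝ) ≤ (1 - ζ) * n / k →
      ∀ H : Finset (Finset (Fin (n / k) ⊕ Fin n)),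
        (∀ e ∈ H, (e.filter fun v => v.isLeft = true).card = 1 ∧ e.card = k + 1) →
        (∀ i : Fin (n / k), (i : ℕ) < t →
          Nat.choose n k - Nat.choose (n - t + 1) k <
            (H.filter fun e => Sum.inl i ∈ e).card) →
        (∀ i : Fin (n / k), t ≤ (i : ℕ) →
          (H.filter fun e => Sum.inl i ∈ e).card = Nat.choose n k) →
        ∀ R : Finset (Fin (n / k) ⊕ Fin n), R.card = k + 1 →
          (R.filter fun v => v.isRight = true).card
            = k * (R.filter fun v => v.isLeft = true).card →
          ζ ^ k * (Nat.choose n k : ℝ) ^ (k + 1) / (6 * (k : ℝ) ^ 2 * 2 ^ k * ((k ^ 2).factorial : ℝ))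
            ≤ (((Finset.univ.powersetCard (k * (k + 1))).filter fun Q =>
                ((Q.filter fun v => v.isRight = true).card
                  = k * (Q.filter fun v => v.isLeft = true).card) ∧
                (∃ M ⊆ H, (∀ e ∈ M, ∀ f ∈ M, e ≠ f → Disjoint e f) ∧ M.biUnion id = Q) ∧
                (∃ M ⊆ H, M.card = k + 1 ∧ (∀ e ∈ M, ∀ f ∈ M, e ≠ f → Disjoint e f) ∧
                  ∀ e ∈ M, e ⊆ Q ∪ R)).card : ℝ) := by
  refine ⟨max (6 * k ^ 2 * (1 + k ^ 2)) ⌈2 * (k : ℝ) * (k + 1) / ζ⌉₊, ?_⟩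
  intro n hn t ht1 ht2 H hH hdeg hdeg' R hR hRb
  have hn1 : 6 * k ^ 2 * (1 + k ^ 2) ≤ n := (le_max_left _ _).trans hn
  have hn2 : 2 * (k : ℝ) * (k + 1) ≤ ζ * n := by
    rw [mul_comm ζ, ← div_le_iff₀ hζ]
    exact (Nat.le_ceil _).trans (by exact_mod_cast (le_max_right _ _).trans hn)
  have hk0 : (3 : ℝ) ≤ k := by exact_mod_cast hk
  have hnR : 6 * (k : ℝ) ^ 2 * (1 + k ^ 2) ≤ n := by exact_mod_cast hn1
  have hn0 : (0 : ℝ) < n := lt_of_lt_of_le (by positivity) hnR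
  have htpos : 1 ≤ t := by
    have : (0 : ℝ) < t := lt_of_lt_of_le (by positivity) ht1
    exact_mod_cast this
  have ht3 : (t : ℝ) ≤ n / k - ζ * n / k := by
    calc (t : ℝ) ≤ (1 - ζ) * n / k := ht2
      _ = _ := by ring
  have htn : t ≤ n := by
    have h1 : 0 ≤ ζ * n / k := by positivity
    have h2 : (n : ℝ) / k ≤ n := div_le_self hn0.le (by linarith)
    have : (t : ℝ) ≤ n := by linarith
    exact_mod_cast this
  have hRsplit := card_toLeft_add_card_toRight (u := R)
  rw [card_filter_isLeft, card_filter_isRight] at hRb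
  have hRL : #R.toLeft = 1 := by
    rw [hRb, hR] at hRsplit
    refine Nat.eq_of_mul_eq_mul_left (by omega : 0 < k + 1) ?_
    linarith
  obtain ⟨a, ha⟩ := card_eq_one.1 hRL
  set T := R.toRight with hTdef
  have hT : #T = k := by rw [hRb, hRL, mul_one]
  have hRe : R = ({a} : Finset _).disjSum T := by rw [← ha, hTdef, toLeft_disjSum_toRight]
  set N : Fin (n / k) → Finset (Finset (Fin n)) := fun i =>
    {U ∈ (univ : Finset (Fin n)).powersetCard k | ({i} : Finset _).disjSum U ∈ H} with hNdef
  have hNdeg : ∀ i, #{e ∈ H | Sum.inl i ∈ e} ≤ #(N i) := fun i =>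
    degree_le_card_neighbourhood H hH i
  have hNsub : ∀ i, N i ⊆ univ.powersetCard k := fun i => filter_subset _ _
  have hfull : ∀ i : Fin (n / k), t ≤ (i : ℕ) → ∀ A : Finset (Fin n), #A = k →
      ({i} : Finset (Fin (n / k))).disjSum A ∈ H := by
    intro i hi A hA
    have hNi : N i = univ.powersetCard k := by
      refine eq_of_subset_of_card_le (hNsub i) ?_
      rw [card_powersetCard, card_univ, Fintype.card_fin, ← hdeg' i hi]
      exact hNdeg i
    have : A ∈ N i := by
      rw [hNi]
      exact mem_powersetCard.2 ⟨subset_univ _, hA⟩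
    exact (mem_filter.1 this).2
  have hda : n.choose k ≤ #(N a) + (n - t + 1).choose k := by
    have := hNdeg a
    rcases lt_or_ge (a : ℕ) t with h | h
    · have := hdeg a h
      omega
    · have := hdeg' a h
      omega
  set N' := N a ∩ Tᶜ.powersetCard k with hN'
  have hcount := card_inter_powersetCard_compl_ge (β := Fin n) (k := k) (t := t) (by omega) htpos
    (by simpa using htn) (N a) (hNsub a) T hT (by simpa using hda)
  rw [Fintype.card_fin, ← hN'] at hcount
  have hN'R : (n.choose k : ℝ) ≤ 6 * k ^ 2 * #N' := by
    have h1 : (t : ℝ) * n.choose k ≤ n * #N' + (1 + k ^ 2) * n.choose k := by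
      exact_mod_cast hcount
    have h2 : (n : ℝ) / (6 * k ^ 2) ≤ t - (1 + k ^ 2) := by
      have h3 : (1 + (k : ℝ) ^ 2) ≤ n / (6 * k ^ 2) := by
        rw [le_div_iff₀ (by positivity)]; linarith
      have h4 : (n : ℝ) / (3 * k ^ 2) = n / (6 * k ^ 2) + n / (6 * k ^ 2) := by
        field_simp; norm_num
      linarith
    have h3 : (n : ℝ) / (6 * k ^ 2) * n.choose k ≤ n * #N' := by
      have := mul_le_mul_of_nonneg_right h2 (Nat.cast_nonneg (α := ℝ) (n.choose k))
      linarith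
    refine le_of_mul_le_mul_left ?_ hn0
    rw [div_mul_eq_mul_div, div_le_iff₀ (by positivity)] at h3
    linarith
  set F := ({i : Fin (n / k) | t ≤ (i : ℕ)} : Finset _).erase a with hF
  have hFcard : ζ * n / k - 2 ≤ #F := by
    have h1 := card_filter_le_val_ge (n / k) t
    have h2 : #{i : Fin (n / k) | t ≤ (i : ℕ)} - 1 ≤ #F := pred_card_le_card_erase
    have h3 : ((n / k : ℕ) : ℝ) ≤ #F + t + 1 := by
      norm_cast
      omega
    have h4 : (n : ℝ) / k < (n / k : ℕ) + 1 := by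
      rw [div_lt_iff₀ (by linarith)]
      exact_mod_cast Nat.lt_mul_of_div_lt (Nat.lt_succ_self (n / k)) (by omega)
    linarith
  set P : Finset (Finset (Fin n)) := {S ∈ Tᶜ.powersetCard (k ^ 2) | ∃ U ∈ N', U ⊆ S} with hPdef
  have hP := card_mul_choose_le_card_supersets_mul (k := k) (l := k ^ 2) (by nlinarith) T N'
    inter_subset_right
  rw [Fintype.card_fin, hT, ← hPdef] at hP
  refine (absorbing_count_le hk hζ hn1 hn2 hFcard hN'R hP).trans ?_
  rw [← card_powersetCard, ← Nat.cast_mul, ← card_product, Nat.cast_le]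
  refine card_le_card_of_injOn (fun p => p.1.disjSum p.2) ?_ ?_
  · rintro ⟨X, S⟩ hXS
    obtain ⟨hX, hS⟩ := mem_product.1 hXS
    obtain ⟨hXF, hXc⟩ := mem_powersetCard.1 hX
    obtain ⟨hS, U, hU, hUS⟩ := mem_filter.1 hS
    obtain ⟨hST, hSc⟩ := mem_powersetCard.1 hS
    have hUN := mem_filter.1 (mem_inter.1 hU).1
    simp only at hXF hXc hSc hST hUS
    rw [mem_coe, mem_filter, card_filter_isLeft, card_filter_isRight, toLeft_disjSum,
      toRight_disjSum, mem_powersetCard, card_disjSum, hXc, hSc, hRe]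
    refine ⟨⟨subset_univ _, by ring⟩, by ring, ?_⟩
    exact exists_matchings_of_full_degree (by omega) H X hXc
      (fun x hx => hfull x (mem_filter.1 (mem_of_mem_erase (hXF hx))).2) a
      (fun h => notMem_erase _ _ (hXF h)) S T U hSc hT (mem_powersetCard.1 hUN.1).2 hUS
      (disjoint_left.2 fun b hb => mem_compl.1 (hST hb)) hUN.2
  · rintro ⟨X, S⟩ - ⟨X', S'⟩ - h
    have h1 := congrArg toLeft h
    have h2 := congrArg toRight h
    simp only [toLeft_disjSum, toRight_disjSum] at h1 h2
    rw [h1, h2]
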